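/- arXiv:1707.01931 — 2 statements merged into one kernel-verified Lean document; each statement's English description precedes it below -/
import Mathlib

section
/- Let λ be the unique real root of λ³ + λ − 1 (λ ≈ 0.6823278). Then the final altitude of a uniformly random Dyck meander with catastrophes of length n admits a geometric limit law: for every fixed k ≥ 0, lim_{n→∞} m_{n,k} / m_n = (1 − λ)·λᵏ. -/
open Filter Topology

/-- Validity of a path with catastrophes over the jump set `J`, starting from
altitude `h`: each step is either a jump `s ∈ J` keeping the altitude
nonnegative, or a catastrophe `s = -h` from an altitude `h > 0` with `-h ∉ J`
(landing at altitude `0`). -/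
def CatValidFrom (J : Finset ℤ) : ℤ → List ℤ → Prop
  | _, [] => True
  | h, s :: r =>
    ((s ∈ J ∧ 0 ≤ h + s) ∨ (s = -h ∧ 0 < h ∧ -h ∉ J)) ∧ CatValidFrom J (h + s) r

/-- The jump set of Dyck paths. For this jump set a catastrophe is a jump
`-h` from an altitude `h ≥ 2` to altitude `0`. -/
def dyckJ : Finset ℤ := {-1, 1}

/-- `l` is a Dyck meander with catastrophes of length `n` (endpoint at any
altitude). -/
def DyckCatMeander (n : ℕ) (l : List ℤ) : Prop :=
  l.length = n ∧ CatValidFrom dyckJ 0 l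

/-- The number `m n` of Dyck meanders with catastrophes of length `n`. -/
noncomputable def mCount (n : ℕ) : ℕ := Nat.card {l : List ℤ // DyckCatMeander n l}

/-- The number `m n k` of Dyck meanders with catastrophes of length `n`
ending at altitude `k`. -/
noncomputable def mkCount (n : ℕ) (k : ℕ) : ℕ :=
  Nat.card {l : List ℤ // DyckCatMeander n l ∧ l.sum = (k : ℤ)}

/-- The words of length `n` which are valid from altitude `h` and end at an altitude in `Q`. -/
def catWords (Q : Set ℤ) (n : ℕ) (h : ℤ) : Set (List ℤ) :=
  {l | l.length = n ∧ CatValidFrom dyckJ h l ∧ h + l.sum ∈ Q}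

theorem mem_dyckJ {s : ℤ} : s ∈ dyckJ ↔ s = -1 ∨ s = 1 := by
  simp [dyckJ]

theorem nil_mem_catWords {Q : Set ℤ} {h : ℤ} : [] ∈ catWords Q 0 h ↔ h ∈ Q := by
  simp [catWords, CatValidFrom]

theorem cons_mem_catWords {Q : Set ℤ} {n : ℕ} {h s : ℤ} {l : List ℤ} :
    s :: l ∈ catWords Q (n + 1) h ↔
      (((s = -1 ∨ s = 1) ∧ 0 ≤ h + s) ∨ (s = -h ∧ 0 < h ∧ ¬(-h = -1 ∨ -h = 1))) ∧
        l ∈ catWords Q n (h + s) := by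
  simp only [catWords, Set.mem_ofPred_eq, List.length_cons, CatValidFrom, List.sum_cons, mem_dyckJ,
    Nat.add_right_cancel_iff, add_assoc]
  tauto

theorem nil_notMem_catWords_succ {Q : Set ℤ} {n : ℕ} {h : ℤ} : [] ∉ catWords Q (n + 1) h := by
  simp [catWords]

theorem catWords_succ_zero (Q : Set ℤ) (n : ℕ) :
    catWords Q (n + 1) 0 = List.cons 1 '' catWords Q n 1 := by
  ext l
  cases l with
  | nil => simp [nil_notMem_catWords_succ]
  | cons s l =>
    rw [cons_mem_catWords]
    simp only [Set.mem_image, List.cons.injEq]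
    constructor
    · rintro ⟨h | h, hl⟩
      · obtain rfl : s = 1 := by omega
        exact ⟨l, by simpa using hl, rfl, rfl⟩
      · omega
    · rintro ⟨_, hl, rfl, rfl⟩
      exact ⟨by norm_num, by simpa using hl⟩

theorem catWords_succ_one (Q : Set ℤ) (n : ℕ) :
    catWords Q (n + 1) 1 = List.cons 1 '' catWords Q n 2 ∪ List.cons (-1) '' catWords Q n 0 := by
  ext l
  cases l with
  | nil => simp [nil_notMem_catWords_succ]
  | cons s l =>
    rw [cons_mem_catWords]
    simp only [Set.mem_union, Set.mem_image, List.cons.injEq]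
    constructor
    · rintro ⟨⟨rfl | rfl, -⟩ | h, hl⟩
      · exact Or.inr ⟨l, by simpa using hl, rfl, rfl⟩
      · exact Or.inl ⟨l, by simpa using hl, rfl, rfl⟩
      · exact absurd (Or.inl trivial) h.2.2
    · rintro (⟨_, hl, rfl, rfl⟩ | ⟨_, hl, rfl, rfl⟩)
      · exact ⟨by norm_num, by simpa using hl⟩
      · exact ⟨by norm_num, by simpa using hl⟩

theorem catWords_succ_of_two_le (Q : Set ℤ) (n : ℕ) {h : ℤ} (hh : 2 ≤ h) :
    catWords Q (n + 1) h =
      List.cons 1 '' catWords Q n (h + 1) ∪ List.cons (-1) '' catWords Q n (h - 1) ∪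
        List.cons (-h) '' catWords Q n 0 := by
  ext l
  cases l with
  | nil => simp [nil_notMem_catWords_succ]
  | cons s l =>
    rw [cons_mem_catWords]
    simp only [Set.mem_union, Set.mem_image, List.cons.injEq]
    constructor
    · rintro ⟨⟨rfl | rfl, -⟩ | ⟨rfl, -⟩, hl⟩
      · exact Or.inl (Or.inr ⟨l, hl, rfl, rfl⟩)
      · exact Or.inl (Or.inl ⟨l, hl, rfl, rfl⟩)
      · exact Or.inr ⟨l, by simpa using hl, rfl, rfl⟩
    · rintro ((⟨_, hl, rfl, rfl⟩ | ⟨_, hl, rfl, rfl⟩) | ⟨_, hl, rfl, rfl⟩)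
      · exact ⟨Or.inl ⟨Or.inr rfl, by omega⟩, hl⟩
      · exact ⟨Or.inl ⟨Or.inl rfl, by omega⟩, hl⟩
      · exact ⟨Or.inr ⟨rfl, by omega⟩, by simpa using hl⟩

theorem disjoint_image_cons {s t : ℤ} (hst : s ≠ t) (A B : Set (List ℤ)) :
    Disjoint (List.cons s '' A) (List.cons t '' B) := by
  rw [Set.disjoint_left]
  rintro _ ⟨a, -, rfl⟩ ⟨b, -, hb⟩
  exact hst (List.cons.inj hb).1.symm

theorem ncard_image_cons (s : ℤ) (A : Set (List ℤ)) : (List.cons s '' A).ncard = A.ncard :=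
  Set.ncard_image_of_injective A List.cons_injective

/-- The operator taking a function `f` of the altitude to the function whose value at `k` is the
sum of `f` over the altitudes reachable from `k` in one step. -/
def catStep : (ℕ → ℝ) →ₗ[ℝ] (ℕ → ℝ) where
  toFun f
    | 0 => f 1
    | 1 => f 2 + f 0
    | k + 2 => f (k + 3) + f (k + 1) + f 0
  map_add' f g := by
    funext k
    rcases k with _ | _ | k <;> simp only [Pi.add_apply] <;> ring
  map_smul' c f := by
    funext k
    rcases k with _ | _ | k <;> simp only [Pi.smul_apply, smul_eq_mul, RingHom.id_apply] <;> ring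

theorem catStep_zero (f : ℕ → ℝ) : catStep f 0 = f 1 := rfl

theorem catStep_one (f : ℕ → ℝ) : catStep f 1 = f 2 + f 0 := rfl

theorem catStep_add_two (f : ℕ → ℝ) (k : ℕ) :
    catStep f (k + 2) = f (k + 3) + f (k + 1) + f 0 := rfl

theorem finite_catWords (Q : Set ℤ) (n k : ℕ) : (catWords Q n k).Finite := by
  induction n generalizing k with
  | zero =>
    refine (Set.finite_singleton ([] : List ℤ)).subset fun l hl => ?_
    exact List.length_eq_zero_iff.mp hl.1
  | succ n ih =>
    rcases k with _ | _ | k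
    · rw [Nat.cast_zero, catWords_succ_zero]
      exact (mod_cast ih 1 : (catWords Q n 1).Finite).image _
    · rw [zero_add, Nat.cast_one, catWords_succ_one]
      exact ((mod_cast ih 2 : (catWords Q n 2).Finite).image _).union
        ((mod_cast ih 0 : (catWords Q n 0).Finite).image _)
    · rw [catWords_succ_of_two_le Q n (by push_cast; omega)]
      have h₁ := ih (k + 3)
      have h₂ := ih (k + 1)
      have h₀ := ih 0
      push_cast at h₀ h₁ h₂ ⊢
      rw [show (k : ℤ) + 1 + 1 + 1 = k + 3 by ring, show (k : ℤ) + 1 + 1 - 1 = k + 1 by ring]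
      exact ((h₁.image _).union (h₂.image _)).union (h₀.image _)

theorem ncard_catWords (Q : Set ℤ) (n k : ℕ) :
    ((catWords Q n k).ncard : ℝ) =
      (catStep ^ n) (fun j : ℕ => Set.indicator Q (fun _ => (1 : ℝ)) (j : ℤ)) k := by
  induction n generalizing k with
  | zero =>
    have hnil : ∀ l ∈ catWords Q 0 k, l = [] := fun l hl => List.length_eq_zero_iff.mp hl.1
    by_cases hk : (k : ℤ) ∈ Q
    · have : catWords Q 0 k = {[]} :=
        Set.eq_singleton_iff_unique_mem.mpr ⟨nil_mem_catWords.mpr hk, hnil⟩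
      simp [this, hk]
    · have : catWords Q 0 k = ∅ := Set.eq_empty_of_forall_notMem fun l hl =>
        hk (nil_mem_catWords.mp (hnil l hl ▸ hl))
      simp [this, hk]
  | succ n ih =>
    rw [pow_succ', Module.End.mul_apply]
    have hfin := finite_catWords Q n
    rcases k with _ | _ | k
    · rw [catStep_zero, ← ih, Nat.cast_zero, catWords_succ_zero, ncard_image_cons, Nat.cast_one]
    · have h₂ := hfin 2
      have h₀ := hfin 0
      rw [zero_add, catStep_one, ← ih, ← ih]
      push_cast at h₀ h₂ ⊢
      rw [catWords_succ_one, Set.ncard_union_eq (disjoint_image_cons (by norm_num) _ _)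
        (h₂.image _) (h₀.image _), ncard_image_cons, ncard_image_cons, Nat.cast_add]
    · have h₁ := hfin (k + 3)
      have h₂ := hfin (k + 1)
      have h₀ := hfin 0
      rw [catStep_add_two, ← ih, ← ih, ← ih, catWords_succ_of_two_le Q n (by push_cast; omega)]
      push_cast at h₀ h₁ h₂ ⊢
      rw [show (k : ℤ) + 1 + 1 + 1 = k + 3 by ring, show (k : ℤ) + 1 + 1 - 1 = k + 1 by ring]
      rw [Set.ncard_union_eq (Set.disjoint_union_left.mpr
          ⟨disjoint_image_cons (by omega) _ _, disjoint_image_cons (by omega) _ _⟩)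
          ((h₁.image _).union (h₂.image _)) (h₀.image _),
        Set.ncard_union_eq (disjoint_image_cons (by norm_num) _ _) (h₁.image _) (h₂.image _)]
      simp only [ncard_image_cons, Nat.cast_add]

theorem mCount_eq (n : ℕ) : (mCount n : ℝ) = (catStep ^ n) 1 0 := by
  have h := ncard_catWords Set.univ n 0
  simp only [Set.indicator_univ] at h
  refine Eq.trans ?_ h
  simp [mCount, catWords, DyckCatMeander, ← Nat.card_coe_set_eq]
  rfl

theorem mkCount_eq (n k : ℕ) : (mkCount n k : ℝ) = (catStep ^ n) (Pi.single k 1) 0 := by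
  have h := ncard_catWords {(k : ℤ)} n 0
  have hs : (fun j : ℕ => Set.indicator {(k : ℤ)} (fun _ => (1 : ℝ)) (j : ℤ)) = Pi.single k 1 := by
    funext j
    simp [Set.indicator_apply, Pi.single_apply]
  rw [hs] at h
  refine Eq.trans ?_ h
  simp [mkCount, catWords, DyckCatMeander, and_assoc, ← Nat.card_coe_set_eq]
  rfl

theorem catStep_mono : Monotone catStep := by
  intro f g hfg k
  rcases k with _ | _ | k
  · exact hfg 1
  · exact add_le_add (hfg 2) (hfg 0)
  · exact add_le_add (add_le_add (hfg (k + 3)) (hfg (k + 1))) (hfg 0)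

theorem le_catStep {f : ℕ → ℝ} (hf : 0 ≤ f) (k : ℕ) : f (k + 1) ≤ catStep f k := by
  rcases k with _ | _ | k
  · exact le_rfl
  · rw [catStep_one]
    linarith [show (0 : ℝ) ≤ f 0 from hf 0]
  · rw [catStep_add_two]
    linarith [show (0 : ℝ) ≤ f 0 from hf 0, show (0 : ℝ) ≤ f (k + 1) from hf (k + 1)]

theorem le_catStep_pow_three {f : ℕ → ℝ} (hf : 0 ≤ f) (k : ℕ) : f 0 ≤ (catStep ^ 3) f k := by
  have h₁ : 0 ≤ catStep f := by simpa using catStep_mono hf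
  have h₂ : 0 ≤ catStep (catStep f) := by simpa using catStep_mono h₁
  calc f 0 ≤ catStep f (k + 2) := by
        rw [catStep_add_two]
        linarith [show (0 : ℝ) ≤ f (k + 3) from hf _, show (0 : ℝ) ≤ f (k + 1) from hf _]
    _ ≤ catStep (catStep f) (k + 1) := le_catStep h₁ _
    _ ≤ catStep (catStep (catStep f)) k := le_catStep h₂ _

/-- The positive eigenfunction of `catStep`, for the eigenvalue `(lam ^ 2)⁻¹`. -/
def catWeight (lam : ℝ) : ℕ → ℝ
  | 0 => lam ^ 5
  | k + 1 => 1 - lam ^ (k + 1)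

section

variable {lam : ℝ}

theorem root_pos (hlam : lam ^ 3 + lam - 1 = 0) : 0 < lam := by
  by_contra! h
  nlinarith [mul_nonneg (neg_nonneg.mpr h) (sq_nonneg lam)]

theorem root_lt_one (hlam : lam ^ 3 + lam - 1 = 0) : lam < 1 := by
  have := pow_pos (root_pos hlam) 3
  linarith

theorem catStep_catWeight (hlam : lam ^ 3 + lam - 1 = 0) :
    lam ^ 2 • catStep (catWeight lam) = catWeight lam := by
  funext k
  rw [Pi.smul_apply, smul_eq_mul]
  rcases k with _ | _ | k
  · simp only [catStep_zero, catWeight]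
    linear_combination (-lam ^ 2) * hlam
  · simp only [zero_add, catStep_one, catWeight]
    linear_combination (lam ^ 4 - lam ^ 2 + 1) * hlam
  · simp only [catStep_add_two, catWeight]
    linear_combination (lam ^ 4 - lam ^ 2 + lam + 1 - lam ^ (k + 2)) * hlam

theorem catWeight_le_one (hlam : lam ^ 3 + lam - 1 = 0) (k : ℕ) : catWeight lam k ≤ 1 := by
  cases k with
  | zero => exact pow_le_one₀ (root_pos hlam).le (root_lt_one hlam).le
  | succ k =>
    have := pow_pos (root_pos hlam) (k + 1)
    simp only [catWeight]
    linarith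

theorem le_catWeight (hlam : lam ^ 3 + lam - 1 = 0) (k : ℕ) : lam ^ 5 ≤ catWeight lam k := by
  have h₀ := (root_pos hlam).le
  have h₁ := (root_lt_one hlam).le
  cases k with
  | zero => exact le_rfl
  | succ k =>
    have h53 : lam ^ 5 ≤ lam ^ 3 := pow_le_pow_of_le_one h₀ h₁ (by norm_num)
    have hk : lam ^ (k + 1) ≤ lam ^ 1 := pow_le_pow_of_le_one h₀ h₁ (by omega)
    simp only [catWeight]
    linarith

theorem smul_catStep_mono (lam : ℝ) : Monotone (lam ^ 2 • catStep) := fun _ _ h =>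
  smul_le_smul_of_nonneg_left (catStep_mono h) (sq_nonneg lam)

theorem smul_catStep_pow_mono (lam : ℝ) (n : ℕ) : Monotone ((lam ^ 2 • catStep) ^ n) := by
  rw [Module.End.coe_pow]
  exact (smul_catStep_mono lam).iterate n

theorem smul_catStep_pow_smul_catWeight (hlam : lam ^ 3 + lam - 1 = 0) (n : ℕ) (c : ℝ) :
    ((lam ^ 2 • catStep) ^ n) (c • catWeight lam) = c • catWeight lam := by
  rw [map_smul, Module.End.coe_pow, Function.iterate_fixed (catStep_catWeight hlam)]

theorem smul_catWeight_le_pow_three (hlam : lam ^ 3 + lam - 1 = 0) {f : ℕ → ℝ} (hf : 0 ≤ f) :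
    (lam ^ 6 * f 0) • catWeight lam ≤ ((lam ^ 2 • catStep) ^ 3) f := by
  intro k
  have h₀ : (0 : ℝ) ≤ lam ^ 6 * f 0 := mul_nonneg (by positivity) (hf 0)
  have h₁ := mul_le_mul_of_nonneg_left (catWeight_le_one hlam k) h₀
  have h₂ := mul_le_mul_of_nonneg_left (le_catStep_pow_three hf k) (by positivity : 0 ≤ lam ^ 6)
  rw [smul_pow, ← pow_mul, show 2 * 3 = 6 from rfl]
  simp only [Pi.smul_apply, smul_eq_mul, LinearMap.smul_apply]
  linarith

theorem smul_catStep_pow_bounds (hlam : lam ^ 3 + lam - 1 = 0) {f : ℕ → ℝ} {a b : ℝ}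
    (ha : a • catWeight lam ≤ f) (hb : f ≤ b • catWeight lam) (j : ℕ) :
    ∃ a' b' : ℝ, b' - a' = (1 - lam ^ 11) ^ j * (b - a) ∧
      a' • catWeight lam ≤ ((lam ^ 2 • catStep) ^ (3 * j)) f ∧
      ((lam ^ 2 • catStep) ^ (3 * j)) f ≤ b' • catWeight lam := by
  induction j with
  | zero => exact ⟨a, b, by simp, by simpa using ha, by simpa using hb⟩
  | succ j ih =>
    obtain ⟨a', b', hab, ha', hb'⟩ := ih
    rw [show 3 * (j + 1) = 3 + 3 * j by ring, pow_add (lam ^ 2 • catStep), Module.End.mul_apply]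
    generalize ((lam ^ 2 • catStep) ^ (3 * j)) f = g at ha' hb'
    have h₁ := smul_catWeight_le_pow_three hlam (sub_nonneg.mpr ha')
    have h₂ := smul_catWeight_le_pow_three hlam (sub_nonneg.mpr hb')
    rw [map_sub, smul_catStep_pow_smul_catWeight hlam] at h₁ h₂
    refine ⟨a' + lam ^ 6 * (g 0 - a' * lam ^ 5), b' - lam ^ 6 * (b' * lam ^ 5 - g 0), ?_, ?_, ?_⟩
    · rw [pow_succ]
      linear_combination (1 - lam ^ 11) * hab
    · rw [add_smul]
      exact add_le_of_le_sub_left h₁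
    · rw [sub_smul]
      exact le_sub_comm.mp h₂

theorem exists_tendsto_smul_catStep_pow (hlam : lam ^ 3 + lam - 1 = 0) {f : ℕ → ℝ}
    (hf₀ : 0 ≤ f) (hf₁ : f ≤ 1) :
    ∃ x, Tendsto (fun n => ((lam ^ 2 • catStep) ^ n) f 0) atTop (𝓝 x) := by
  have hpos := root_pos hlam
  have h5 : 0 < lam ^ 5 := pow_pos hpos 5
  have ha : (0 : ℝ) • catWeight lam ≤ f := by simpa using hf₀
  have hb : f ≤ (lam ^ 5)⁻¹ • catWeight lam := fun k => by
    refine (hf₁ k).trans ?_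
    rw [Pi.smul_apply, smul_eq_mul, Pi.one_apply, ← inv_mul_cancel₀ h5.ne']
    exact mul_le_mul_of_nonneg_left (le_catWeight hlam k) (by positivity)
  have hq : Tendsto (fun j : ℕ => (1 - lam ^ 11) ^ j * ((lam ^ 5)⁻¹ - 0) * lam ^ 5) atTop (𝓝 0) := by
    have h11 : 0 < lam ^ 11 := pow_pos hpos 11
    have h11' : lam ^ 11 < 1 := pow_lt_one₀ hpos.le (root_lt_one hlam) (by norm_num)
    simpa using ((tendsto_pow_atTop_nhds_zero_of_lt_one (by linarith) (by linarith)).mul_const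
      ((lam ^ 5)⁻¹ - 0)).mul_const (lam ^ 5)
  refine cauchySeq_tendsto_of_complete (Metric.cauchySeq_iff.mpr fun ε hε => ?_)
  obtain ⟨j, hj⟩ := (hq.eventually_lt_const hε).exists
  obtain ⟨a, b, hab, ha', hb'⟩ := smul_catStep_pow_bounds hlam ha hb j
  have hmem : ∀ n ≥ 3 * j,
      ((lam ^ 2 • catStep) ^ n) f 0 ∈ Set.Icc (a * lam ^ 5) (b * lam ^ 5) := by
    intro n hn
    obtain ⟨i, rfl⟩ := Nat.exists_eq_add_of_le' hn
    have h₁ := smul_catStep_pow_mono lam i ha' 0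
    have h₂ := smul_catStep_pow_mono lam i hb' 0
    rw [smul_catStep_pow_smul_catWeight hlam] at h₁ h₂
    rw [pow_add, Module.End.mul_apply]
    exact ⟨h₁, h₂⟩
  refine ⟨3 * j, fun m hm n hn => (Real.dist_le_of_mem_Icc (hmem m hm) (hmem n hn)).trans_lt ?_⟩
  rwa [← sub_mul, hab]

theorem catStep_single_zero : catStep (Pi.single 0 1) = 1 - Pi.single 0 1 := by
  funext k
  rcases k with _ | _ | k <;>
    simp [catStep_zero, catStep_one, catStep_add_two]

theorem catStep_single_succ (j : ℕ) :
    catStep (Pi.single (j + 1) 1) = Pi.single j 1 + Pi.single (j + 2) 1 := by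
  funext k
  rcases k with _ | _ | k
  · simp [catStep_zero, Pi.single_apply, eq_comm]
  · simp [catStep_one, Pi.single_apply, eq_comm, add_comm]
  · simp [catStep_add_two, Pi.single_apply]

theorem catStep_const_one :
    catStep 1 = (3 : ℝ) • (1 : ℕ → ℝ) - (2 : ℝ) • Pi.single 0 1 - Pi.single 1 1 := by
  funext k
  rcases k with _ | _ | k
  · norm_num [catStep_zero, Pi.single_apply]
  · norm_num [catStep_one, Pi.single_apply]
  · norm_num [catStep_add_two, Pi.single_apply]

theorem tendsto_pow_smul_catStep_apply {f : ℕ → ℝ} {x : ℝ}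
    (h : Tendsto (fun n => ((lam ^ 2 • catStep) ^ n) f 0) atTop (𝓝 x)) :
    Tendsto (fun n => lam ^ 2 * ((lam ^ 2 • catStep) ^ n) (catStep f) 0) atTop (𝓝 x) := by
  refine ((tendsto_add_atTop_iff_nat 1).mpr h).congr fun n => ?_
  rw [pow_succ, Module.End.mul_apply, LinearMap.smul_apply, map_smul, Pi.smul_apply, smul_eq_mul]

theorem tendsto_smul_catStep_pow_single (hlam : lam ^ 3 + lam - 1 = 0) {x : ℝ}
    (hx : Tendsto (fun n => ((lam ^ 2 • catStep) ^ n) 1 0) atTop (𝓝 x)) (k : ℕ) :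
    Tendsto (fun n => ((lam ^ 2 • catStep) ^ n) (Pi.single k 1) 0) atTop
      (𝓝 ((1 - lam) * lam ^ k * x)) := by
  have hne : lam ^ 2 ≠ 0 := (pow_pos (root_pos hlam) 2).ne'
  have hlim : ∀ j : ℕ, ∃ y, Tendsto (fun n => ((lam ^ 2 • catStep) ^ n) (Pi.single j 1) 0) atTop
      (𝓝 y) := fun j => exists_tendsto_smul_catStep_pow hlam
    (fun i => by by_cases h : i = j <;> simp [h])
    (fun i => by by_cases h : i = j <;> simp [h])
  choose y hy using hlim
  have h₀ : y 0 = lam ^ 2 * (x - y 0) := by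
    refine tendsto_nhds_unique (tendsto_pow_smul_catStep_apply (hy 0)) ?_
    simp only [catStep_single_zero, map_sub, Pi.sub_apply]
    exact (hx.sub (hy 0)).const_mul _
  have h₁ : x = lam ^ 2 * (3 * x - 2 * y 0 - y 1) := by
    refine tendsto_nhds_unique (tendsto_pow_smul_catStep_apply hx) ?_
    simp only [catStep_const_one, map_sub, map_smul, Pi.sub_apply, Pi.smul_apply, smul_eq_mul]
    exact (((hx.const_mul _).sub ((hy 0).const_mul _)).sub (hy 1)).const_mul _
  have h₂ : ∀ j, y (j + 1) = lam ^ 2 * (y j + y (j + 2)) := fun j => by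
    refine tendsto_nhds_unique (tendsto_pow_smul_catStep_apply (hy (j + 1))) ?_
    simp only [catStep_single_succ, map_add, Pi.add_apply]
    exact ((hy j).add (hy (j + 2))).const_mul _
  have e₀ : y 0 = (1 - lam) * x := by
    have : (1 + lam ^ 2) ≠ 0 := by positivity
    refine mul_left_cancel₀ this ?_
    linear_combination h₀ + x * hlam
  have e₁ : y 1 = (1 - lam) * lam * x := by
    refine mul_left_cancel₀ hne ?_
    rw [e₀] at h₁
    linear_combination h₁ + (1 + lam) * x * hlam
  have e : ∀ j, y j = (1 - lam) * lam ^ j * x ∧ y (j + 1) = (1 - lam) * lam ^ (j + 1) * x := by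
    intro j
    induction j with
    | zero => exact ⟨by simpa using e₀, by simpa using e₁⟩
    | succ j ih =>
      refine ⟨ih.2, mul_left_cancel₀ hne ?_⟩
      have := h₂ j
      rw [ih.1, ih.2] at this
      linear_combination -this - (1 - lam) * lam ^ (j + 1) * x * hlam
  exact (e k).1 ▸ hy k

end

/-- **Geometric limit law for the final altitude.** Let `λ` be the unique real
root of `λ³ + λ - 1` (`λ ≈ 0.6823278`). For every fixed `k ≥ 0`,
`m_{n,k} / m_n → (1 - λ)·λᵏ`. -/
theorem finalAltitude_geometric (lam : ℝ) (hlam : lam ^ 3 + lam - 1 = 0) (k : ℕ) :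
    Tendsto (fun n : ℕ => (mkCount n k : ℝ) / (mCount n : ℝ)) atTop
      (𝓝 ((1 - lam) * lam ^ k)) := by
  have hpos := root_pos hlam
  have hone : (1 : ℝ) • catWeight lam ≤ 1 := fun i => by simpa using catWeight_le_one hlam i
  obtain ⟨x, hx⟩ := exists_tendsto_smul_catStep_pow hlam zero_le_one (le_refl 1)
  have hx₀ : lam ^ 5 ≤ x := ge_of_tendsto' hx fun n => by
    have h := smul_catStep_pow_mono lam n hone 0
    rw [smul_catStep_pow_smul_catWeight hlam] at h
    simpa [catWeight] using h
  have hxne : x ≠ 0 := ((pow_pos hpos 5).trans_le hx₀).ne'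
  have h := (tendsto_smul_catStep_pow_single hlam hx k).div hx hxne
  rw [mul_div_cancel_right₀ _ hxne] at h
  refine h.congr fun n => ?_
  have hn : (lam ^ 2) ^ n ≠ 0 := by positivity
  rw [mCount_eq, mkCount_eq, Pi.div_apply, smul_pow]
  simp only [LinearMap.smul_apply, Pi.smul_apply, smul_eq_mul]
  exact mul_div_mul_left _ _ hn
end

section
/- Let λ be the unique real root of λ³ + λ − 1 (λ ≈ 0.6823278). For n ≥ 0 let P_{n,k} be the number of pairs (w, c) where w is a Dyck path with catastrophes of length n and c is a catastrophe of w of size k, let P_n = Σ_k P_{n,k}, and let N_n be the number of Dyck paths with catastrophes of length n containing no catastrophe. Then the size of a uniformly random catastrophe admits a shifted geometric limit law: for every fixed k ≥ 2, lim_{n→∞} P_{n,k} / (N_n + P_n) = (1 − λ)·λ^{k−2}, and for k ∈ {0, 1} the corresponding limit (with numerator N_n for k = 0 and P_{n,1} for k = 1) is 0. -/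
open Filter Topology

/-- The number of catastrophe steps of a path starting at altitude `h`. -/
def catNum (J : Finset ℤ) : ℤ → List ℤ → ℕ
  | _, [] => 0
  | h, s :: r => (if s = -h ∧ 0 < h ∧ -h ∉ J then 1 else 0) + catNum J (h + s) r

/-- `l` is a Dyck path with catastrophes of length `n`. -/
def DyckCat (n : ℕ) (l : List ℤ) : Prop :=
  l.length = n ∧ CatValidFrom dyckJ 0 l ∧ l.sum = 0

/-- Step number `i` (0-indexed) of the Dyck path with catastrophes `l` is a
catastrophe of size `k`: it starts at altitude `k ≥ 2` and jumps down to `0`. -/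
def CatAt (l : List ℤ) (i : ℕ) (k : ℤ) : Prop :=
  i < l.length ∧ (l.take i).sum = k ∧ l.getD i 0 = -k ∧ 2 ≤ k

/-- `P n k`: the number of pairs `(w, c)` where `w` is a Dyck path with
catastrophes of length `n` and `c` is a catastrophe of `w` of size `k`. -/
noncomputable def pairCount (n : ℕ) (k : ℕ) : ℕ :=
  Nat.card {p : List ℤ × ℕ // DyckCat n p.1 ∧ CatAt p.1 p.2 (k : ℤ)}

/-- `P n = Σ_k P n k`: the number of pairs `(w, c)` where `w` is a Dyck path
with catastrophes of length `n` and `c` is a catastrophe of `w`. -/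
noncomputable def pairCountTot (n : ℕ) : ℕ :=
  Nat.card {p : List ℤ × ℕ // DyckCat n p.1 ∧ ∃ k : ℤ, CatAt p.1 p.2 k}

/-- `N n`: the number of Dyck paths with catastrophes of length `n` containing
no catastrophe. -/
noncomputable def noCatCount (n : ℕ) : ℕ :=
  Nat.card {l : List ℤ // DyckCat n l ∧ catNum dyckJ 0 l = 0}

theorem catValidFrom_append (J : Finset ℤ) (h : ℤ) (a b : List ℤ) :
    CatValidFrom J h (a ++ b) ↔ CatValidFrom J h a ∧ CatValidFrom J (h + a.sum) b := by
  induction a generalizing h with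
  | nil => simp [CatValidFrom]
  | cons s r ih => simp [CatValidFrom, ih, and_assoc, add_assoc]

/-- The steps allowed from altitude `h`. -/
def catSteps (h : ℤ) : Finset ℤ :=
  ({1, -1, -h} : Finset ℤ).filter
    fun s => (s ∈ dyckJ ∧ 0 ≤ h + s) ∨ (s = -h ∧ 0 < h ∧ -h ∉ dyckJ)

theorem mem_catSteps (h s : ℤ) :
    s ∈ catSteps h ↔ (s ∈ dyckJ ∧ 0 ≤ h + s) ∨ (s = -h ∧ 0 < h ∧ -h ∉ dyckJ) := by
  simp only [catSteps, dyckJ, Finset.mem_filter, Finset.mem_insert, Finset.mem_singleton]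
  tauto

theorem sum_catSteps (f : ℤ → ℝ) (h : ℤ) (hh : 0 ≤ h) :
    ∑ s ∈ catSteps h, f (h + s) =
      f (h + 1) + (if 1 ≤ h then f (h - 1) else 0) + (if 2 ≤ h then f 0 else 0) := by
  rcases (by omega : h = 0 ∨ h = 1 ∨ 2 ≤ h) with rfl | rfl | h2
  · have : catSteps 0 = {1} := by decide
    simp [this]
  · have : catSteps 1 = {1, -1} := by decide
    simp [this]
  · have : catSteps h = {1, -1, -h} := by
      ext s
      simp only [mem_catSteps, dyckJ, Finset.mem_insert, Finset.mem_singleton]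
      omega
    rw [this, Finset.sum_insert, Finset.sum_insert, Finset.sum_singleton, if_pos (by omega),
      if_pos h2, add_neg_cancel, ← sub_eq_add_neg, add_assoc]
    · simp only [Finset.mem_singleton]; omega
    · simp only [Finset.mem_insert, Finset.mem_singleton]; omega

/-- The paths with catastrophes of length `n` starting at altitude `0`, with arbitrary endpoint. -/
def catPaths : ℕ → Finset (List ℤ)
  | 0 => {[]}
  | n + 1 => ((catPaths n).sigma fun l => catSteps l.sum).image fun p => p.1 ++ [p.2]

theorem mem_catPaths (n : ℕ) (l : List ℤ) :
    l ∈ catPaths n ↔ l.length = n ∧ CatValidFrom dyckJ 0 l := by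
  induction n generalizing l with
  | zero =>
    simp only [catPaths, Finset.mem_singleton, List.length_eq_zero_iff]
    constructor
    · rintro rfl
      exact ⟨rfl, trivial⟩
    · exact fun h => h.1
  | succ n ih =>
    simp only [catPaths, Finset.mem_image, Finset.mem_sigma, ih, mem_catSteps, Sigma.exists]
    constructor
    · rintro ⟨a, s, ⟨⟨ha, hv⟩, hs⟩, rfl⟩
      refine ⟨by simp [ha], (catValidFrom_append _ _ _ _).2 ⟨hv, ?_⟩⟩
      simpa [CatValidFrom] using hs
    · rintro ⟨hl, hv⟩
      rcases List.eq_nil_or_concat l with rfl | ⟨a, s, rfl⟩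
      · simp at hl
      · rw [List.concat_eq_append] at hl hv ⊢
        rw [catValidFrom_append] at hv
        refine ⟨a, s, ⟨⟨by simpa using hl, hv.1⟩, ?_⟩, rfl⟩
        simpa [CatValidFrom] using hv.2

theorem CatValidFrom.sum_nonneg {h : ℤ} {l : List ℤ} (hh : 0 ≤ h)
    (hl : CatValidFrom dyckJ h l) : 0 ≤ h + l.sum := by
  induction l generalizing h with
  | nil => simpa using hh
  | cons s r ih =>
    have := ih (h := h + s) (by rcases hl.1 with h1 | h1 <;> omega) hl.2
    simpa [add_assoc] using this

/-- The sum of `f` over the endpoints of all paths with catastrophes of length `n`. -/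
noncomputable def pathSum (n : ℕ) (f : ℤ → ℝ) : ℝ := ∑ l ∈ catPaths n, f l.sum

theorem pathSum_congr (n : ℕ) {f g : ℤ → ℝ} (h : ∀ x, 0 ≤ x → f x = g x) :
    pathSum n f = pathSum n g :=
  Finset.sum_congr rfl fun l hl =>
    h _ (by simpa using CatValidFrom.sum_nonneg le_rfl ((mem_catPaths n l).1 hl).2)

theorem pathSum_succ (n : ℕ) (f : ℤ → ℝ) :
    pathSum (n + 1) f = pathSum n fun h =>
      f (h + 1) + (if 1 ≤ h then f (h - 1) else 0) + (if 2 ≤ h then f 0 else 0) := by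
  have : pathSum (n + 1) f = pathSum n fun h => ∑ s ∈ catSteps h, f (h + s) := by
    unfold pathSum
    rw [catPaths, Finset.sum_image, Finset.sum_sigma]
    · simp
    · rintro ⟨a, s⟩ _ ⟨b, t⟩ _ h
      obtain ⟨rfl, h⟩ := List.append_inj' h rfl
      simp_all
  rw [this]
  exact pathSum_congr n fun x hx => sum_catSteps f x hx

/-- The number of paths with catastrophes of length `n` ending at altitude `h`. -/
noncomputable def endCount (n : ℕ) (h : ℕ) : ℝ := pathSum n fun x => if x = h then 1 else 0

/-- The number of paths with catastrophes of length `n`. -/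
noncomputable def totCount (n : ℕ) : ℝ := pathSum n fun _ => 1

theorem endCount_zero (h : ℕ) : endCount 0 h = if h = 0 then 1 else 0 := by
  rw [endCount, pathSum, catPaths, Finset.sum_singleton]
  simp [eq_comm]

theorem totCount_zero : totCount 0 = 1 := by simp [totCount, pathSum, catPaths]

theorem endCount_succ_succ (n h : ℕ) :
    endCount (n + 1) (h + 1) = endCount n h + endCount n (h + 2) := by
  have : endCount n h + endCount n (h + 2) = pathSum n fun x =>
      (if x = (h : ℤ) then 1 else 0) + (if x = ((h + 2 : ℕ) : ℤ) then 1 else 0) := by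
    simp only [endCount, pathSum, Finset.sum_add_distrib]
  rw [this, endCount, pathSum_succ]
  refine pathSum_congr n fun x hx => ?_
  push_cast
  split_ifs <;> first | omega | norm_num

theorem endCount_succ_zero (n : ℕ) : endCount (n + 1) 0 = totCount n - endCount n 0 := by
  have : totCount n - endCount n 0 = pathSum n fun x =>
      1 - (if x = ((0 : ℕ) : ℤ) then 1 else 0) := by
    simp only [endCount, totCount, pathSum, Finset.sum_sub_distrib]
  rw [this, endCount, pathSum_succ]
  refine pathSum_congr n fun x hx => ?_
  push_cast
  split_ifs <;> first | omega | norm_num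

theorem totCount_succ (n : ℕ) :
    totCount (n + 1) = 3 * totCount n - 2 * endCount n 0 - endCount n 1 := by
  have : 3 * totCount n - 2 * endCount n 0 - endCount n 1 = pathSum n fun x =>
      3 * 1 - 2 * (if x = ((0 : ℕ) : ℤ) then 1 else 0) - (if x = ((1 : ℕ) : ℤ) then 1 else 0) := by
    simp only [endCount, totCount, pathSum, Finset.sum_sub_distrib, Finset.mul_sum]
  rw [this, totCount, pathSum_succ]
  refine pathSum_congr n fun x hx => ?_
  push_cast
  split_ifs <;> first | omega | norm_num

theorem card_filter_catPaths (n : ℕ) (p : ℤ → Prop) [DecidablePred p] :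
    (((catPaths n).filter fun l => p l.sum).card : ℝ) = pathSum n fun x => if p x then 1 else 0 := by
  rw [pathSum, Finset.card_filter]
  push_cast
  rfl

theorem neg_notMem_dyckJ {k : ℤ} (hk : 2 ≤ k) : -k ∉ dyckJ := by
  simp only [dyckJ, Finset.mem_insert, Finset.mem_singleton]
  omega

/-- Splitting a path at a marked catastrophe whose size satisfies `p`. -/
theorem card_marked (m : ℕ) (p : ℤ → Prop) [DecidablePred p] (hp : ∀ k, p k → 2 ≤ k) :
    (Nat.card {q : List ℤ × ℕ // DyckCat (m + 1) q.1 ∧ ∃ k, p k ∧ CatAt q.1 q.2 k} : ℝ) =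
      ∑ ij ∈ Finset.HasAntidiagonal.antidiagonal m,
        (pathSum ij.1 fun x => if p x then 1 else 0) * endCount ij.2 0 := by
  set A := (Finset.HasAntidiagonal.antidiagonal m).sigma fun ij =>
    ((catPaths ij.1).filter fun l => p l.sum) ×ˢ
      ((catPaths ij.2).filter fun l => l.sum = ((0 : ℕ) : ℤ)) with hA
  have hcard : (A.card : ℝ) = ∑ ij ∈ Finset.HasAntidiagonal.antidiagonal m,
      (pathSum ij.1 fun x => if p x then 1 else 0) * endCount ij.2 0 := by
    rw [hA, Finset.card_sigma]
    push_cast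
    refine Finset.sum_congr rfl fun ij _ => ?_
    rw [Finset.card_product]
    push_cast
    rw [card_filter_catPaths, endCount]
    congr 1
    simpa using card_filter_catPaths ij.2 (fun x => x = ((0 : ℕ) : ℤ))
  rw [← hcard, Nat.subtype_card (A.image fun q =>
    (q.2.1 ++ -q.2.1.sum :: q.2.2, q.2.1.length)), Finset.card_image_of_injOn]
  · rintro ⟨⟨i, j⟩, a, b⟩ h1 ⟨⟨i', j'⟩, a', b'⟩ h2 h
    simp only [hA, Finset.mem_coe, Finset.mem_sigma, Finset.mem_product, Finset.mem_filter,
      mem_catPaths] at h1 h2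
    simp only [Prod.mk.injEq] at h
    obtain ⟨rfl, h3⟩ := List.append_inj h.1 h.2
    obtain rfl := (List.cons.inj h3).2
    obtain ⟨-, ⟨⟨rfl, -⟩, -⟩, ⟨rfl, -⟩, -⟩ := h1
    obtain ⟨-, ⟨⟨rfl, -⟩, -⟩, ⟨rfl, -⟩, -⟩ := h2
    rfl
  · rintro ⟨l, i⟩
    simp only [hA, Finset.mem_image, Finset.mem_sigma, Finset.mem_product, Finset.mem_filter,
      mem_catPaths, Sigma.exists, Prod.exists, Prod.mk.injEq,
      Finset.HasAntidiagonal.mem_antidiagonal]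
    constructor
    · rintro ⟨i', j, a, b, ⟨hij, ⟨⟨rfl, hva⟩, hpa⟩, ⟨rfl, hvb⟩, hb⟩, rfl, rfl⟩
      have h2 := hp _ hpa
      refine ⟨⟨by simp; omega, ?_, by simp [hb]⟩, a.sum, hpa, by simp, by simp, by simp, h2⟩
      rw [catValidFrom_append, zero_add]
      refine ⟨hva, Or.inr ⟨rfl, by omega, neg_notMem_dyckJ h2⟩, ?_⟩
      rwa [add_neg_cancel]
    · rintro ⟨⟨hl, hv, hs⟩, k, hpk, hi, hk, hget, h2⟩
      have hsplit : l = l.take i ++ -k :: l.drop (i + 1) := by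
        conv_lhs => rw [← List.take_append_drop i l, List.drop_eq_getElem_cons hi]
        rw [List.getD_eq_getElem _ _ hi] at hget
        rw [hget]
      have hlen : (l.take i).length = i := by simp; omega
      rw [hsplit, catValidFrom_append, zero_add, hk] at hv
      rw [hsplit, List.sum_append, List.sum_cons, hk] at hs
      refine ⟨i, m - i, l.take i, l.drop (i + 1),
        ⟨by omega, ⟨⟨hlen, hv.1⟩, by rwa [hk]⟩, ⟨by simp; omega, ?_⟩, ?_⟩, ?_, hlen⟩
      · simpa using hv.2.2
      · push_cast
        linarith
      · rw [hk, ← hsplit]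

theorem pairCount_succ (m k : ℕ) (hk : 2 ≤ k) :
    (pairCount (m + 1) k : ℝ) =
      ∑ ij ∈ Finset.HasAntidiagonal.antidiagonal m, endCount ij.1 k * endCount ij.2 0 := by
  have := card_marked m (fun x => x = (k : ℤ)) (by rintro _ rfl; exact_mod_cast hk)
  simp only [exists_eq_left] at this
  exact this

theorem pairCountTot_succ (m : ℕ) :
    (pairCountTot (m + 1) : ℝ) = ∑ ij ∈ Finset.HasAntidiagonal.antidiagonal m,
      (totCount ij.1 - endCount ij.1 0 - endCount ij.1 1) * endCount ij.2 0 := by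
  have h1 : ∀ n, (pathSum n fun x => if 2 ≤ x then 1 else 0) =
      totCount n - endCount n 0 - endCount n 1 := by
    intro n
    have : totCount n - endCount n 0 - endCount n 1 = pathSum n fun x =>
        1 - (if x = ((0 : ℕ) : ℤ) then 1 else 0) - (if x = ((1 : ℕ) : ℤ) then 1 else 0) := by
      simp only [endCount, totCount, pathSum, Finset.sum_sub_distrib]
    rw [this]
    refine pathSum_congr n fun x hx => ?_
    push_cast
    split_ifs <;> first | omega | norm_num
  have h2 := card_marked m (fun x => 2 ≤ x) fun _ => id
  simp only [h1] at h2
  rw [← h2, pairCountTot]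
  congr 1
  refine Nat.card_congr (Equiv.subtypeEquivRight fun q => and_congr_right fun _ => ?_)
  exact exists_congr fun k => ⟨fun h => ⟨h.2.2.2, h⟩, fun h => h.2⟩

theorem noCatCount_le (n : ℕ) : (noCatCount n : ℝ) ≤ endCount n 0 := by
  have h1 : endCount n 0 = (((catPaths n).filter fun l => l.sum = ((0 : ℕ) : ℤ)).card : ℝ) :=
    (card_filter_catPaths n fun x => x = ((0 : ℕ) : ℤ)).symm
  rw [h1, noCatCount, Nat.subtype_card (((catPaths n).filter fun l => l.sum = ((0 : ℕ) : ℤ)).filter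
    fun l => catNum dyckJ 0 l = 0)]
  · exact_mod_cast Finset.card_le_card (Finset.filter_subset _ _)
  · intro l
    simp only [Finset.mem_filter, mem_catPaths, DyckCat]
    push_cast
    tauto

theorem pairCount_one (n : ℕ) : pairCount n 1 = 0 := by
  have : IsEmpty {p : List ℤ × ℕ // DyckCat n p.1 ∧ CatAt p.1 p.2 ((1 : ℕ) : ℤ)} :=
    ⟨fun q => absurd q.2.2.2.2.2 (by norm_num)⟩
  exact Nat.card_of_isEmpty

section Series

open PowerSeries

/-- The coefficients of `f` are absolutely summable. -/
def AbsSummable (f : ℝ⟦X⟧) : Prop := Summable fun n => ‖coeff n f‖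

/-- The sum of the coefficients of `f`. -/
noncomputable def coeffSum (f : ℝ⟦X⟧) : ℝ := ∑' n, coeff n f

theorem AbsSummable.add {f g : ℝ⟦X⟧} (hf : AbsSummable f) (hg : AbsSummable g) :
    AbsSummable (f + g) :=
  Summable.of_nonneg_of_le (fun _ => norm_nonneg _)
    (fun n => by rw [map_add]; exact norm_add_le _ _) (Summable.add hf hg)

theorem AbsSummable.mul {f g : ℝ⟦X⟧} (hf : AbsSummable f) (hg : AbsSummable g) :
    AbsSummable (f * g) := by
  have := summable_norm_sum_mul_antidiagonal_of_summable_norm hf hg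
  simpa only [AbsSummable, coeff_mul] using this

theorem AbsSummable.neg {f : ℝ⟦X⟧} (hf : AbsSummable f) : AbsSummable (-f) := by
  simpa [AbsSummable] using hf

theorem AbsSummable.sub {f g : ℝ⟦X⟧} (hf : AbsSummable f) (hg : AbsSummable g) :
    AbsSummable (f - g) := by
  rw [sub_eq_add_neg]
  exact hf.add hg.neg

theorem absSummable_C (a : ℝ) : AbsSummable (C a) :=
  summable_of_ne_finset_zero (s := {0}) fun n hn => by
    rw [coeff_C, if_neg (by simpa using hn), norm_zero]

theorem absSummable_one : AbsSummable 1 := by simpa using absSummable_C 1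

theorem absSummable_X : AbsSummable X :=
  summable_of_ne_finset_zero (s := {1}) fun n hn => by
    rw [coeff_X, if_neg (by simpa using hn), norm_zero]

theorem AbsSummable.pow {f : ℝ⟦X⟧} (hf : AbsSummable f) (k : ℕ) : AbsSummable (f ^ k) := by
  induction k with
  | zero => simpa using absSummable_one
  | succ k ih => rw [pow_succ]; exact ih.mul hf

theorem coeffSum_add {f g : ℝ⟦X⟧} (hf : AbsSummable f) (hg : AbsSummable g) :
    coeffSum (f + g) = coeffSum f + coeffSum g := by
  simp only [coeffSum, map_add]
  exact hf.of_norm.tsum_add hg.of_norm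

theorem coeffSum_sub {f g : ℝ⟦X⟧} (hf : AbsSummable f) (hg : AbsSummable g) :
    coeffSum (f - g) = coeffSum f - coeffSum g := by
  simp only [coeffSum, map_sub]
  exact hf.of_norm.tsum_sub hg.of_norm

theorem coeffSum_mul {f g : ℝ⟦X⟧} (hf : AbsSummable f) (hg : AbsSummable g) :
    coeffSum (f * g) = coeffSum f * coeffSum g := by
  simp only [coeffSum, coeff_mul]
  exact (tsum_mul_tsum_eq_tsum_sum_antidiagonal_of_summable_norm hf hg).symm

theorem coeffSum_C (a : ℝ) : coeffSum (C a) = a := by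
  rw [coeffSum, tsum_eq_single 0 fun n hn => by rw [coeff_C, if_neg hn]]
  simp

theorem coeffSum_one : coeffSum 1 = 1 := by simpa using coeffSum_C 1

theorem coeffSum_X : coeffSum X = 1 := by
  rw [coeffSum, tsum_eq_single 1 fun n hn => by rw [coeff_X, if_neg hn]]
  simp

theorem coeffSum_pow {f : ℝ⟦X⟧} (hf : AbsSummable f) (k : ℕ) :
    coeffSum (f ^ k) = coeffSum f ^ k := by
  induction k with
  | zero => simpa using coeffSum_one
  | succ k ih => rw [pow_succ, coeffSum_mul (hf.pow k) hf, ih, pow_succ]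

theorem coeff_eq_sum_of_one_sub_X_mul {f g : ℝ⟦X⟧} (h : (1 - X) * f = g) (n : ℕ) :
    coeff n f = ∑ j ∈ Finset.range (n + 1), coeff j g := by
  subst h
  induction n with
  | zero => simp
  | succ n ih =>
    rw [Finset.sum_range_succ, ← ih, sub_mul, one_mul, map_sub, coeff_succ_X_mul]
    ring

theorem tendsto_coeff_of_one_sub_X_mul {f g : ℝ⟦X⟧} (h : (1 - X) * f = g) (hg : AbsSummable g) :
    Tendsto (fun n => coeff n f) atTop (𝓝 (coeffSum g)) := by
  simp only [coeff_eq_sum_of_one_sub_X_mul h]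
  exact hg.of_norm.hasSum.tendsto_sum_nat.comp (tendsto_add_atTop_nat 1)

theorem tendsto_coeff_div_of_one_sub_X_sq_mul {f g : ℝ⟦X⟧} (h : (1 - X) ^ 2 * f = g)
    (hg : AbsSummable g) :
    Tendsto (fun n : ℕ => coeff n f / ((n + 1 : ℕ) : ℝ)) atTop (𝓝 (coeffSum g)) := by
  have h1 := tendsto_coeff_of_one_sub_X_mul (f := (1 - X) * f) (by rw [← h]; ring) hg
  refine (h1.cesaro.comp (tendsto_add_atTop_nat 1)).congr fun n => ?_
  rw [coeff_eq_sum_of_one_sub_X_mul (f := f) rfl n, div_eq_inv_mul]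
  rfl

theorem sum_norm_coeff_X_mul_le (f : ℝ⟦X⟧) (N : ℕ) :
    ∑ n ∈ Finset.range N, ‖coeff n (X * f)‖ ≤ ∑ n ∈ Finset.range N, ‖coeff n f‖ := by
  cases N with
  | zero => simp
  | succ N =>
    rw [Finset.sum_range_succ', Finset.sum_range_succ]
    simp [coeff_succ_X_mul]

theorem AbsSummable.of_quadratic_mul {f g : ℝ⟦X⟧} {b c : ℝ} (hb : 0 ≤ b) (hc : 0 ≤ c)
    (hbc : b + c < 1) (h : (1 + C b * X + C c * X ^ 2) * f = g) (hg : AbsSummable g) :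
    AbsSummable f := by
  refine summable_of_sum_range_le (c := (∑' n, ‖coeff n g‖) / (1 - b - c))
    (fun _ => norm_nonneg _) fun N => ?_
  rw [le_div_iff₀ (by linarith)]
  have h1 : ∑ n ∈ Finset.range N, ‖coeff n g‖ ≤ ∑' n, ‖coeff n g‖ :=
    hg.sum_le_tsum _ fun _ _ => norm_nonneg _
  have h2 := sum_norm_coeff_X_mul_le f N
  have h3 := sum_norm_coeff_X_mul_le (X * f) N
  have h4 : ∑ n ∈ Finset.range N, ‖coeff n f‖ ≤
      ∑ n ∈ Finset.range N, (‖coeff n g‖ + b * ‖coeff n (X * f)‖ + c * ‖coeff n (X * (X * f))‖) := by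
    refine Finset.sum_le_sum fun n _ => ?_
    have : f = g - C b * (X * f) - C c * (X * (X * f)) := by rw [← h]; ring
    have h5 : coeff n f = coeff n g - b * coeff n (X * f) - c * coeff n (X * (X * f)) := by
      conv_lhs => rw [this]
      simp only [map_sub, coeff_C_mul]
    rw [h5]
    refine (norm_sub_le _ _).trans (add_le_add ((norm_sub_le _ _).trans ?_) ?_)
    · rw [norm_mul, Real.norm_of_nonneg hb]
    · rw [norm_mul, Real.norm_of_nonneg hc]
  rw [Finset.sum_add_distrib, Finset.sum_add_distrib, ← Finset.mul_sum, ← Finset.mul_sum] at h4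
  have h6 := mul_le_mul_of_nonneg_left h2 hb
  have h7 := mul_le_mul_of_nonneg_left (h3.trans h2) hc
  linarith

theorem exists_eq_X_mul_one_add_sq (r : ℝ) : ∃ u : ℝ⟦X⟧, u = C r * X * (1 + u ^ 2) := by
  have h := congrArg (fun f => expand 2 two_ne_zero (map (Nat.castRingHom ℝ) f))
    catalanSeries_sq_mul_X_add_one
  simp only [map_add, map_mul, map_pow, map_one, map_X, expand_X] at h
  set c := expand 2 two_ne_zero (map (Nat.castRingHom ℝ) catalanSeries)
  have h1 : X * c = X * (1 + (X * c) ^ 2) := by linear_combination -X * h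
  refine ⟨rescale r (X * c), ?_⟩
  conv_lhs => rw [h1]
  simp only [map_mul, map_add, map_pow, map_one, rescale_X]

theorem sum_coeff_sq_le {f : ℝ⟦X⟧} (hf : ∀ n, 0 ≤ coeff n f) (N : ℕ) :
    ∑ n ∈ Finset.range N, coeff n (f ^ 2) ≤ (∑ n ∈ Finset.range N, coeff n f) ^ 2 := by
  rw [sq (∑ n ∈ Finset.range N, coeff n f), Finset.sum_mul_sum, ← Finset.sum_product']
  simp only [sq f, coeff_mul]
  rw [← Finset.sum_biUnion]
  · refine Finset.sum_le_sum_of_subset_of_nonneg ?_ fun _ _ _ => mul_nonneg (hf _) (hf _)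
    intro x hx
    simp only [Finset.mem_biUnion, Finset.mem_range, Finset.HasAntidiagonal.mem_antidiagonal,
      Finset.mem_product] at hx ⊢
    omega
  · intro i _ j _ hij
    refine Finset.disjoint_left.2 fun x hx hx' => hij ?_
    rw [Finset.HasAntidiagonal.mem_antidiagonal] at hx hx'
    omega

theorem absSummable_and_coeffSum_of_eq {u : ℝ⟦X⟧} {a : ℝ} (h0 : 0 < a) (h1 : a < 1)
    (ha : a ^ 2 * (1 + a ^ 2) = a) (hu : u = C (a ^ 2) * X * (1 + u ^ 2)) :
    AbsSummable u ∧ coeffSum u = a := by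
  have hc0 : coeff 0 u = 0 := by rw [hu]; simp [mul_assoc]
  have hcs : ∀ n, coeff (n + 1) u = a ^ 2 * (coeff n (1 : ℝ⟦X⟧) + coeff n (u ^ 2)) := by
    intro n
    conv_lhs => rw [hu]
    rw [mul_assoc, coeff_C_mul, coeff_succ_X_mul, map_add]
  have hpos : ∀ n, 0 ≤ coeff n u := by
    intro n
    induction n using Nat.strong_induction_on with
    | _ n ih =>
      cases n with
      | zero => exact hc0.ge
      | succ n =>
        rw [hcs, sq u, coeff_mul, coeff_one]
        refine mul_nonneg (sq_nonneg _) (add_nonneg (by split_ifs <;> norm_num) ?_)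
        refine Finset.sum_nonneg fun x hx => ?_
        rw [Finset.HasAntidiagonal.mem_antidiagonal] at hx
        exact mul_nonneg (ih _ (by omega)) (ih _ (by omega))
  have hsum : ∀ N, ∑ n ∈ Finset.range N, coeff n u ≤ a := by
    intro N
    induction N with
    | zero => simpa using h0.le
    | succ N ih =>
      rw [Finset.sum_range_succ', hc0, add_zero]
      simp only [hcs]
      rw [← Finset.mul_sum, Finset.sum_add_distrib]
      have h2 : ∑ n ∈ Finset.range N, coeff n (1 : ℝ⟦X⟧) ≤ 1 := by
        simp only [coeff_one, Finset.sum_ite_eq']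
        split_ifs <;> norm_num
      have h3 := sum_coeff_sq_le hpos N
      have h4 := pow_le_pow_left₀ (Finset.sum_nonneg fun n (_ : n ∈ Finset.range N) => hpos n) ih 2
      exact (mul_le_mul_of_nonneg_left (add_le_add h2 (h3.trans h4)) (sq_nonneg a)).trans ha.le
  have hS : AbsSummable u := by
    refine summable_of_sum_range_le (c := a) (fun _ => norm_nonneg _) fun N => ?_
    simpa only [Real.norm_of_nonneg (hpos _)] using hsum N
  refine ⟨hS, ?_⟩
  have hle : coeffSum u ≤ a := Real.tsum_le_of_sum_range_le hpos hsum
  have heq := congrArg coeffSum hu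
  rw [coeffSum_mul ((absSummable_C _).mul absSummable_X) (absSummable_one.add (hS.pow 2)),
    coeffSum_mul (absSummable_C _) absSummable_X, coeffSum_add absSummable_one (hS.pow 2),
    coeffSum_pow hS, coeffSum_C, coeffSum_X, coeffSum_one] at heq
  have h5 : (coeffSum u - a) * (a ^ 2 * (coeffSum u + a) - 1) = 0 := by
    linear_combination -ha - heq
  rcases mul_eq_zero.1 h5 with h6 | h6
  · linarith
  · exfalso
    nlinarith [mul_le_mul_of_nonneg_left hle (sq_nonneg a), pow_pos h0 2, pow_pos h0 3]

/-- If `E 0 = 0` and the series `E h` satisfy the Dyck step recursion, they all vanish. -/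
theorem eq_zero_of_step_recursion {r : ℝ} {E : ℕ → ℝ⟦X⟧} (h0 : E 0 = 0)
    (hE : ∀ h, E (h + 1) = C r * X * (E h + E (h + 2))) (h : ℕ) : E h = 0 := by
  ext n
  rw [map_zero]
  induction n generalizing h with
  | zero =>
    cases h with
    | zero => simp [h0]
    | succ h => rw [hE]; simp [mul_assoc]
  | succ n ih =>
    cases h with
    | zero => simp [h0]
    | succ h => rw [hE, mul_assoc, coeff_C_mul, coeff_succ_X_mul, map_add, ih, ih]; simp

/-- The generating function of `endCount · h`, with the variable scaled by `r`. -/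
noncomputable def endSeries (r : ℝ) (h : ℕ) : ℝ⟦X⟧ := mk fun n => endCount n h * r ^ n

/-- The generating function of `totCount`, with the variable scaled by `r`. -/
noncomputable def totSeries (r : ℝ) : ℝ⟦X⟧ := mk fun n => totCount n * r ^ n

theorem endSeries_succ (r : ℝ) (h : ℕ) :
    endSeries r (h + 1) = C r * X * (endSeries r h + endSeries r (h + 2)) := by
  ext n
  cases n with
  | zero => simp [mul_assoc, endSeries, endCount_zero]
  | succ n =>
    rw [mul_assoc, coeff_C_mul, coeff_succ_X_mul]
    simp only [endSeries, map_add, coeff_mk, endCount_succ_succ]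
    ring

theorem endSeries_zero (r : ℝ) :
    endSeries r 0 = 1 + C r * X * (totSeries r - endSeries r 0) := by
  ext n
  cases n with
  | zero => simp [mul_assoc, endSeries, endCount_zero]
  | succ n =>
    rw [mul_assoc, map_add, coeff_C_mul, coeff_succ_X_mul, coeff_one, if_neg (by omega)]
    simp only [endSeries, totSeries, map_sub, coeff_mk, endCount_succ_zero]
    ring

theorem totSeries_eq (r : ℝ) :
    totSeries r = 1 + C r * X * (C 3 * totSeries r - C 2 * endSeries r 0 - endSeries r 1) := by
  ext n
  cases n with
  | zero => simp [mul_assoc, totSeries, totCount_zero]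
  | succ n =>
    rw [mul_assoc, map_add, coeff_C_mul, coeff_succ_X_mul, coeff_one, if_neg (by omega)]
    simp only [endSeries, totSeries, map_sub, coeff_C_mul, coeff_mk, totCount_succ]
    ring

theorem endSeries_eq_pow_mul {r : ℝ} {u : ℝ⟦X⟧} (hu : u = C r * X * (1 + u ^ 2)) (h : ℕ) :
    endSeries r h = u ^ h * endSeries r 0 := by
  refine sub_eq_zero.1 (eq_zero_of_step_recursion (r := r)
    (E := fun h => endSeries r h - u ^ h * endSeries r 0) (by simp) (fun h => ?_) h)
  rw [endSeries_succ]
  linear_combination -u ^ h * endSeries r 0 * hu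

/-- The algebraic equation for the generating function of paths ending at altitude `0`. -/
theorem endSeries_zero_mul {r : ℝ} {u z : ℝ⟦X⟧} (hz : z = C r * X) (hu : u = z * (1 + u ^ 2)) :
    endSeries r 0 * (1 - z - 2 * z ^ 2 - z ^ 3) = 1 - z - z ^ 2 - z ^ 2 * u := by
  have h1 := endSeries_eq_pow_mul (r := r) (by rwa [hz] at hu) 1
  have h2 := endSeries_zero r
  have h3 := totSeries_eq r
  rw [← hz] at h2 h3
  have hC2 : (C 2 : ℝ⟦X⟧) = 2 := map_ofNat C 2
  have hC3 : (C 3 : ℝ⟦X⟧) = 3 := map_ofNat C 3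
  rw [hC2, hC3] at h3
  have e1 : endSeries r 0 * (1 - 2 * z - z ^ 2 + z ^ 2 * u) = 1 - 2 * z := by
    linear_combination z * h3 + (1 - 3 * z) * h2 - z ^ 2 * h1
  have hne : (1 - 2 * z : ℝ⟦X⟧) ≠ 0 := by
    intro h
    have := congrArg constantCoeff h
    simp [hz] at this
  refine mul_left_cancel₀ hne ?_
  linear_combination (1 - z - z ^ 2 - z ^ 2 * u) * e1 - endSeries r 0 * z ^ 3 * hu

theorem coeff_endSeries (r : ℝ) (n h : ℕ) : coeff n (endSeries r h) = endCount n h * r ^ n :=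
  coeff_mk _ _

theorem coeff_marked_size (r : ℝ) (m : ℕ) {k : ℕ} (hk : 2 ≤ k) :
    coeff (m + 1) (C r * X * (endSeries r k * endSeries r 0)) =
      pairCount (m + 1) k * r ^ (m + 1) := by
  rw [mul_assoc, coeff_C_mul, coeff_succ_X_mul, coeff_mul, pairCount_succ m k hk, Finset.mul_sum,
    Finset.sum_mul]
  refine Finset.sum_congr rfl fun ij hij => ?_
  rw [Finset.HasAntidiagonal.mem_antidiagonal] at hij
  rw [← hij, coeff_endSeries, coeff_endSeries]
  ring

theorem coeff_marked (r : ℝ) (m : ℕ) :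
    coeff (m + 1) (C r * X * ((totSeries r - endSeries r 0 - endSeries r 1) * endSeries r 0)) =
      pairCountTot (m + 1) * r ^ (m + 1) := by
  rw [mul_assoc, coeff_C_mul, coeff_succ_X_mul, coeff_mul, pairCountTot_succ m, Finset.mul_sum,
    Finset.sum_mul]
  refine Finset.sum_congr rfl fun ij hij => ?_
  rw [Finset.HasAntidiagonal.mem_antidiagonal] at hij
  rw [← hij]
  simp only [map_sub, coeff_endSeries, totSeries, coeff_mk]
  ring

/-- Dominant asymptotics of all the counting sequences, up to a common positive constant. -/
theorem exists_asymptotics {a : ℝ} (h0 : 0 < a) (h1 : a < 1) (ha : a ^ 3 + a - 1 = 0) :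
    ∃ c : ℝ, 0 < c ∧
      (∀ k, 2 ≤ k → Tendsto (fun m : ℕ => (pairCount (m + 1) k : ℝ) *
        ((a ^ 2) ^ (m + 1) / ((m + 1 + 1 : ℕ) : ℝ))) atTop (𝓝 (a ^ (k + 2) * c))) ∧
      Tendsto (fun m : ℕ => (noCatCount (m + 1) : ℝ) *
        ((a ^ 2) ^ (m + 1) / ((m + 1 + 1 : ℕ) : ℝ))) atTop (𝓝 0) ∧
      Tendsto (fun m : ℕ => (pairCountTot (m + 1) : ℝ) *
        ((a ^ 2) ^ (m + 1) / ((m + 1 + 1 : ℕ) : ℝ))) atTop (𝓝 (a * c)) := by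
  obtain ⟨u, hu⟩ := exists_eq_X_mul_one_add_sq (a ^ 2)
  obtain ⟨hus, huv⟩ := absSummable_and_coeffSum_of_eq h0 h1 (by linear_combination a * ha) hu
  obtain ⟨z, hz⟩ : ∃ z : ℝ⟦X⟧, z = C (a ^ 2) * X := ⟨_, rfl⟩
  have hzs : AbsSummable z := hz ▸ (absSummable_C _).mul absSummable_X
  have hzv : coeffSum z = a ^ 2 := by
    rw [hz, coeffSum_mul (absSummable_C _) absSummable_X, coeffSum_C, coeffSum_X, mul_one]
  have hD := endSeries_zero_mul hz (by rwa [hz])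
  have hDk := endSeries_eq_pow_mul hu
  have hD0 := endSeries_zero (a ^ 2)
  rw [← hz] at hD0
  set D := endSeries (a ^ 2) 0 with hDdef
  set K := (1 - X) * D with hK
  have hw : AbsSummable (1 - z - z ^ 2 - z ^ 2 * u) :=
    ((absSummable_one.sub hzs).sub (hzs.pow 2)).sub ((hzs.pow 2).mul hus)
  have hKeq : (1 + C (1 - a ^ 2) * X + C (a ^ 6) * X ^ 2) * K = 1 - z - z ^ 2 - z ^ 2 * u := by
    have hL := congrArg (C : ℝ → ℝ⟦X⟧) ha
    simp only [map_sub, map_add, map_pow, map_one, map_zero] at hL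
    rw [hK, ← hD, hz]
    simp only [map_sub, map_pow, map_one]
    linear_combination D * X ^ 2 * (C a ^ 3 + C a + 1) * hL
  have ha2 : a ^ 2 < 1 := by nlinarith
  have hKs : AbsSummable K := by
    refine AbsSummable.of_quadratic_mul (by linarith) (by positivity) ?_ hKeq hw
    have : a ^ 6 = a ^ 2 * a ^ 4 := by ring
    nlinarith [pow_pos h0 2, pow_lt_one₀ h0.le h1 (n := 4) (by norm_num)]
  have hKpos : 0 < coeffSum K := by
    have h2 := congrArg coeffSum hKeq
    have hX := absSummable_X
    have hq1 := (absSummable_C (1 - a ^ 2)).mul hX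
    have hq2 := (absSummable_C (a ^ 6)).mul (hX.pow 2)
    rw [coeffSum_mul ((absSummable_one.add hq1).add hq2) hKs,
      coeffSum_add (absSummable_one.add hq1) hq2, coeffSum_add absSummable_one hq1,
      coeffSum_mul (absSummable_C _) hX, coeffSum_mul (absSummable_C _) (hX.pow 2),
      coeffSum_pow hX, coeffSum_sub ((absSummable_one.sub hzs).sub (hzs.pow 2))
        ((hzs.pow 2).mul hus), coeffSum_sub (absSummable_one.sub hzs) (hzs.pow 2),
      coeffSum_sub absSummable_one hzs, coeffSum_mul (hzs.pow 2) hus, coeffSum_pow hzs] at h2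
    simp only [coeffSum_C, coeffSum_X, coeffSum_one, hzv, huv] at h2
    have h3 : a < 7 / 10 := by
      by_contra! h
      nlinarith [pow_le_pow_left₀ (by norm_num) h 3]
    have h4 : 0 < (1 + (1 - a ^ 2) * 1 + a ^ 6 * 1 ^ 2) * coeffSum K := by
      rw [h2, show 1 - a ^ 2 - (a ^ 2) ^ 2 - (a ^ 2) ^ 2 * a = 2 - 2 * a - a ^ 2 by
        linear_combination (-a - a ^ 2 + 1) * ha]
      nlinarith
    refine pos_of_mul_pos_right h4 ?_
    nlinarith [pow_pos h0 6]
  have hlin : Tendsto (fun m : ℕ => endCount (m + 1) 0 *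
      ((a ^ 2) ^ (m + 1) / ((m + 1 + 1 : ℕ) : ℝ))) atTop (𝓝 0) := by
    have h2 := (tendsto_coeff_of_one_sub_X_mul hK.symm hKs).mul
      (tendsto_one_div_add_atTop_nhds_zero_nat (𝕜 := ℝ))
    rw [mul_zero] at h2
    refine (h2.comp (tendsto_add_atTop_nat 1)).congr fun m => ?_
    simp only [Function.comp, hDdef, coeff_endSeries]
    push_cast
    ring
  refine ⟨coeffSum K ^ 2, by positivity, fun k hk => ?_, ?_, ?_⟩
  · have h2 : (1 - X) ^ 2 * (z * (endSeries (a ^ 2) k * D)) = z * u ^ k * K ^ 2 := by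
      rw [hDk, hK]
      ring
    have h3 := tendsto_coeff_div_of_one_sub_X_sq_mul h2 ((hzs.mul (hus.pow k)).mul (hKs.pow 2))
    rw [coeffSum_mul (hzs.mul (hus.pow k)) (hKs.pow 2), coeffSum_mul hzs (hus.pow k),
      coeffSum_pow hus, coeffSum_pow hKs, hzv, huv, ← pow_add, add_comm 2] at h3
    refine (h3.comp (tendsto_add_atTop_nat 1)).congr fun m => ?_
    simp only [Function.comp, hDdef, hz]
    rw [coeff_marked_size _ _ hk, mul_div_assoc]
  · refine squeeze_zero (fun m => by positivity) (fun m => ?_) hlin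
    exact mul_le_mul_of_nonneg_right (noCatCount_le _) (by positivity)
  · have h2 : (1 - X) ^ 2 * (z * ((totSeries (a ^ 2) - D - endSeries (a ^ 2) 1) * D) + D) =
        (1 - z * u) * K ^ 2 := by
      rw [hDk 1, hK]
      linear_combination -(1 - X) ^ 2 * D * hD0
    have hzu := hzs.mul hus
    have h3 := tendsto_coeff_div_of_one_sub_X_sq_mul h2
      ((absSummable_one.sub hzu).mul (hKs.pow 2))
    rw [coeffSum_mul (absSummable_one.sub hzu) (hKs.pow 2), coeffSum_sub absSummable_one hzu,
      coeffSum_mul hzs hus, coeffSum_pow hKs, coeffSum_one, hzv, huv] at h3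
    have h4 := (h3.comp (tendsto_add_atTop_nat 1)).sub hlin
    rw [sub_zero, show 1 - a ^ 2 * a = a by linear_combination -ha] at h4
    refine h4.congr fun m => ?_
    simp only [Function.comp, hDdef, hz, map_add]
    rw [coeff_marked, coeff_endSeries]
    ring

end Series

/-- **Shifted geometric limit law for the size of a random catastrophe.**
Let `λ` be the unique real root of `λ³ + λ - 1` (`λ ≈ 0.6823278`). Then for
every fixed `k ≥ 2`, `P_{n,k} / (N_n + P_n) → (1 - λ)·λ^{k-2}`, and for
`k ∈ {0, 1}` the corresponding limit (with numerator `N_n` for `k = 0` and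
`P_{n,1}` for `k = 1`) is `0`. -/
theorem catastropheSize_geometric (lam : ℝ) (hlam : lam ^ 3 + lam - 1 = 0) :
    (∀ k : ℕ, 2 ≤ k →
      Tendsto (fun n : ℕ =>
          (pairCount n k : ℝ) / ((noCatCount n : ℝ) + (pairCountTot n : ℝ)))
        atTop (𝓝 ((1 - lam) * lam ^ (k - 2)))) ∧
    Tendsto (fun n : ℕ =>
        (noCatCount n : ℝ) / ((noCatCount n : ℝ) + (pairCountTot n : ℝ)))
      atTop (𝓝 0) ∧
    Tendsto (fun n : ℕ =>
        (pairCount n 1 : ℝ) / ((noCatCount n : ℝ) + (pairCountTot n : ℝ)))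
      atTop (𝓝 0) := by
  have h0 : 0 < lam := by
    by_contra! h
    nlinarith [mul_nonneg_of_nonpos_of_nonpos h h, sq_nonneg lam]
  have h1 : lam < 1 := by
    nlinarith [pow_pos h0 3]
  obtain ⟨c, hc, hk, hN, hP⟩ := exists_asymptotics h0 h1 hlam
  have hden := hN.add hP
  rw [zero_add] at hden
  have hne : lam * c ≠ 0 := by positivity
  have key : ∀ (x : ℕ → ℕ) (l : ℝ), Tendsto (fun m : ℕ => (x (m + 1) : ℝ) *
      ((lam ^ 2) ^ (m + 1) / ((m + 1 + 1 : ℕ) : ℝ))) atTop (𝓝 l) →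
      Tendsto (fun n : ℕ => (x n : ℝ) / ((noCatCount n : ℝ) + (pairCountTot n : ℝ)))
        atTop (𝓝 (l / (lam * c))) := by
    intro x l hx
    rw [← tendsto_add_atTop_iff_nat 1]
    refine (hx.div hden hne).congr fun m => ?_
    simp only [Pi.div_apply]
    rw [← add_mul, mul_div_mul_right _ _ (by positivity)]
  refine ⟨fun k h2 => ?_, ?_, ?_⟩
  · convert key (fun n => pairCount n k) _ (hk k h2) using 2
    obtain ⟨j, rfl⟩ := Nat.exists_eq_add_of_le h2
    rw [eq_div_iff hne, Nat.add_sub_cancel_left]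
    linear_combination (-(lam ^ (j + 1) * c)) * hlam
  · simpa using key noCatCount 0 hN
  · simp [pairCount_one]
end
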